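/- The cochain DG algebra B₅ with underlying graded algebra k⟨x₁,x₂⟩ (generators in degree 1) and differential given by ∂(x₁) = x₁², ∂(x₂) = 0 has cohomology the polynomial algebra on the class of x₂: for every j ≥ 0, Hʲ(B₅) is one-dimensional, spanned by the class of x₂ʲ. -/

import Mathlib

/-- The degree-`i` homogeneous component of the free algebra `k⟨x_1,...,x_n⟩`
with all generators in degree `1`: the span of the words of length `i`. -/
noncomputable def deg (k : Type*) [CommRing k] (n : ℕ) (i : ℕ) :
    Submodule k (FreeAlgebra k (Fin n)) :=
  Submodule.span k
    {w | ∃ f : Fin i → Fin n, w = (List.ofFn fun j => FreeAlgebra.ι k (f j)).prod}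

open FreeAlgebra in
lemma deg_mul_mem {k : Type*} [Field k] (i : Fin 2) (n : ℕ) (u : FreeAlgebra k (Fin 2))
    (hu : u ∈ deg k 2 n) : ι k i * u ∈ deg k 2 (n + 1) := by
  unfold deg at hu
  induction hu using Submodule.span_induction with
  | mem w hw =>
    obtain ⟨f, rfl⟩ := hw
    refine Submodule.subset_span ⟨Fin.cons i f, ?_⟩
    simp [List.ofFn_succ]
  | zero => simp
  | add a b _ _ ha hb => rw [mul_add]; exact add_mem ha hb
  | smul c a _ ha => rw [mul_smul_comm]; exact Submodule.smul_mem _ _ ha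

lemma deg_one_mem {k : Type*} [Field k] : (1 : FreeAlgebra k (Fin 2)) ∈ deg k 2 0 :=
  Submodule.subset_span ⟨Fin.elim0, by simp⟩

lemma deg_zero_eq {k : Type*} [Field k] (a : FreeAlgebra k (Fin 2)) (ha : a ∈ deg k 2 0) :
    ∃ c : k, a = c • 1 := by
  unfold deg at ha
  induction ha using Submodule.span_induction with
  | mem w hw =>
    obtain ⟨f, rfl⟩ := hw
    exact ⟨1, by simp⟩
  | zero => exact ⟨0, by simp⟩
  | add a b _ _ ha hb =>
    obtain ⟨c, rfl⟩ := ha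
    obtain ⟨e, rfl⟩ := hb
    exact ⟨c + e, by rw [add_smul]⟩
  | smul c a _ ha =>
    obtain ⟨e, rfl⟩ := ha
    exact ⟨c * e, by rw [mul_smul]⟩

open FreeAlgebra in
lemma deg_succ_decomp {k : Type*} [Field k] (n : ℕ) (a : FreeAlgebra k (Fin 2))
    (ha : a ∈ deg k 2 (n + 1)) :
    ∃ u ∈ deg k 2 n, ∃ v ∈ deg k 2 n, a = ι k 0 * u + ι k 1 * v := by
  unfold deg at ha
  induction ha using Submodule.span_induction with
  | mem w hw =>
    obtain ⟨f, rfl⟩ := hw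
    have hm : (List.ofFn fun j => ι k (f (Fin.succ j))).prod ∈ deg k 2 n :=
      Submodule.subset_span ⟨fun j => f j.succ, rfl⟩
    rcases (by omega : f 0 = 0 ∨ f 0 = 1) with h | h
    · exact ⟨_, hm, 0, zero_mem _, by simp [List.ofFn_succ, h]⟩
    · exact ⟨0, zero_mem _, _, hm, by simp [List.ofFn_succ, h]⟩
  | zero => exact ⟨0, zero_mem _, 0, zero_mem _, by simp⟩
  | add a b _ _ ha hb =>
    obtain ⟨u, hu, v, hv, rfl⟩ := ha
    obtain ⟨u', hu', v', hv', rfl⟩ := hb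
    exact ⟨u + u', add_mem hu hu', v + v', add_mem hv hv', by simp only [mul_add]; abel⟩
  | smul c a _ ha =>
    obtain ⟨u, hu, v, hv, rfl⟩ := ha
    exact ⟨c • u, Submodule.smul_mem _ _ hu, c • v, Submodule.smul_mem _ _ hv, by
      simp only [mul_smul_comm, smul_add]⟩

/-- Left Fox derivatives, packaged as a matrix representation. -/
noncomputable def foxHom (k : Type*) [Field k] (i : Fin 2) :
    FreeAlgebra k (Fin 2) →ₐ[k] Matrix (Fin 2) (Fin 2) (FreeAlgebra k (Fin 2)) :=
  FreeAlgebra.lift k fun j => !![0, if j = i then 1 else 0; 0, FreeAlgebra.ι k j]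

open FreeAlgebra in
lemma foxHom_row {k : Type*} [Field k] (i : Fin 2) (a : FreeAlgebra k (Fin 2)) :
    foxHom k i a 1 0 = 0 ∧ foxHom k i a 1 1 = a := by
  induction a using FreeAlgebra.induction with
  | grade0 r => simp [Matrix.algebraMap_matrix_apply]
  | grade1 x => simp [foxHom]
  | mul a b ha hb => simp [Matrix.mul_apply, Fin.sum_univ_two, ha, hb]
  | add a b ha hb => simp [ha, hb]

open FreeAlgebra in
lemma foxHom_ι_mul {k : Type*} [Field k] (i j : Fin 2) (a : FreeAlgebra k (Fin 2)) :
    foxHom k i (ι k j * a) 0 1 = if j = i then a else 0 := by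
  rw [map_mul, Matrix.mul_apply, Fin.sum_univ_two, (foxHom_row i a).2]
  simp [foxHom]

open FreeAlgebra in
lemma left_indep {k : Type*} [Field k] (p q : FreeAlgebra k (Fin 2))
    (h : ι k 0 * p + ι k 1 * q = 0) : p = 0 ∧ q = 0 := by
  constructor
  · have := congrArg (fun z => foxHom k 0 z 0 1) h
    simpa only [map_add, Matrix.add_apply, foxHom_ι_mul, map_zero, Matrix.zero_apply, if_true,
      one_ne_zero, if_false, add_zero] using this
  · have := congrArg (fun z => foxHom k 1 z 0 1) h
    simpa only [map_add, Matrix.add_apply, foxHom_ι_mul, map_zero, Matrix.zero_apply, if_true,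
      zero_ne_one, if_false, zero_add] using this

/-- the cochain DG algebra `B₅` on `k⟨x₁,x₂⟩` with
`∂(x₁) = x₁²`, `∂(x₂) = 0` has cohomology the polynomial algebra on the
class of `x₂`: for every `j ≥ 0`, `Hʲ(B₅)` is one-dimensional, spanned by
the class of `x₂ʲ` (it is a cocycle, not a coboundary for `j ≥ 1`, and every
degree-`j` cocycle is a scalar multiple of it modulo coboundaries). -/
theorem stmt9 {k : Type*} [Field k] [CharZero k]
    (d : FreeAlgebra k (Fin 2) →ₗ[k] FreeAlgebra k (Fin 2))
    (hL : ∀ (p : ℕ) (a b : FreeAlgebra k (Fin 2)), a ∈ deg k 2 p →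
      d (a * b) = d a * b + ((-1 : k) ^ p) • (a * d b))
    (h1 : d (FreeAlgebra.ι k 0) = FreeAlgebra.ι k 0 * FreeAlgebra.ι k 0)
    (h2 : d (FreeAlgebra.ι k 1) = 0)
    (hdd : ∀ x, d (d x) = 0) :
    (∀ j : ℕ, (FreeAlgebra.ι k 1) ^ j ∈ deg k 2 j ∧ d ((FreeAlgebra.ι k 1) ^ j) = 0) ∧
    (∀ j : ℕ, 1 ≤ j → ¬ ∃ b ∈ deg k 2 (j - 1), d b = (FreeAlgebra.ι k 1) ^ j) ∧
    (∀ j : ℕ, ∀ a ∈ deg k 2 j, d a = 0 →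
      ∃ c : k, ∃ b ∈ deg k 2 (j - 1), a = c • (FreeAlgebra.ι k 1) ^ j + d b) := by
  have hι : ∀ i : Fin 2, FreeAlgebra.ι k i ∈ deg k 2 1 := fun i => by
    simpa using deg_mul_mem i 0 1 deg_one_mem
  have d1 : d 1 = 0 := by
    have := hL 0 1 1 deg_one_mem
    simpa using this
  have dx : ∀ u, d (FreeAlgebra.ι k 0 * u)
      = FreeAlgebra.ι k 0 * (FreeAlgebra.ι k 0 * u - d u) := fun u => by
    rw [hL 1 _ u (hι 0), h1, pow_one, neg_one_smul, mul_sub, mul_assoc, sub_eq_add_neg]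
  have dy : ∀ u, d (FreeAlgebra.ι k 1 * u) = FreeAlgebra.ι k 1 * (- d u) := fun u => by
    rw [hL 1 _ u (hι 1), h2, pow_one, neg_one_smul, zero_mul, zero_add, mul_neg]
  refine ⟨fun j => ?_, fun j hj => ?_, ?_⟩
  · induction j with
    | zero => exact ⟨by simpa using deg_one_mem, by simpa using d1⟩
    | succ n ih =>
      rw [pow_succ']
      exact ⟨deg_mul_mem 1 n _ ih.1, by rw [dy, ih.2]; simp⟩
  · rintro ⟨b, hb, hdb⟩
    -- the evaluation killing the first generator and sending the second one to 1
    let φ : FreeAlgebra k (Fin 2) →ₐ[k] k := FreeAlgebra.lift k ![0, 1]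
    have φ0 : φ (FreeAlgebra.ι k 0) = 0 := by simp [φ]
    have φ1 : φ (FreeAlgebra.ι k 1) = 1 := by simp [φ]
    have key : ∀ n, ∀ b ∈ deg k 2 n, φ (d b) = 0 := by
      intro n
      induction n with
      | zero =>
        intro b hb
        obtain ⟨c, rfl⟩ := deg_zero_eq b hb
        rw [map_smul, d1, smul_zero, map_zero]
      | succ n ih =>
        intro b hb
        obtain ⟨u, hu, v, hv, rfl⟩ := deg_succ_decomp n b hb
        rw [map_add, dx, dy, map_add, map_mul, map_mul, φ0, map_neg, ih v hv]
        simp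
    have := key _ b hb
    rw [hdb, map_pow, φ1, one_pow] at this
    exact one_ne_zero this
  · have key : ∀ j : ℕ, ∀ a ∈ deg k 2 j, d a = 0 →
        ∃ c : k, ∃ b ∈ deg k 2 (j - 1), (j = 0 → b = 0) ∧
          a = c • (FreeAlgebra.ι k 1) ^ j + d b := by
      intro j
      induction j with
      | zero =>
        intro a ha _
        obtain ⟨c, rfl⟩ := deg_zero_eq a ha
        exact ⟨c, 0, zero_mem _, fun _ => rfl, by simp⟩
      | succ n ih =>
        intro a ha hda
        obtain ⟨u, hu, v, hv, rfl⟩ := deg_succ_decomp n a ha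
        rw [map_add, dx, dy] at hda
        obtain ⟨hp, hq⟩ := left_indep _ _ hda
        obtain ⟨c, b, hb, hb0, hv'⟩ := ih v hv (neg_eq_zero.mp hq)
        refine ⟨c, u - FreeAlgebra.ι k 1 * b, sub_mem hu ?_, by simp, ?_⟩
        · rcases n with _ | m
          · rw [hb0 rfl, mul_zero]; exact zero_mem _
          · exact deg_mul_mem 1 m b hb
        · rw [map_sub, dy, ← sub_eq_zero.mp hp, hv', pow_succ', mul_add, mul_smul_comm, mul_neg]
          abel
    intro j a ha hda
    obtain ⟨c, b, hb, _, h⟩ := key j a ha hda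
    exact ⟨c, b, hb, h⟩
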